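/- Let n, n' ≥ 1, let Λ = (λ_{i,j}) ∈ M_n(k*) and Λ' = (λ'_{k,t}) ∈ M_{n'}(k*) be multiplicatively antisymmetric, with quantum tori O_Λ((k*)^n) (generators y_i) and O_{Λ'}((k*)^{n'}) (generators y'_k). For h ∈ ℤ write (y'_k)^{(h)} for (y'_k)^h if h ≥ 0 and for (y'_k{}^{-1})^{−h} if h < 0. Then: (a) for every k-algebra homomorphism Φ : O_Λ((k*)^n) → O_{Λ'}((k*)^{n'}) there exist unique α_1,…,α_n ∈ k∖{0} and a unique matrix H = (h_{k,i}) ∈ M_{n'×n}(ℤ) with Φ(y_i) = α_i·(y'_1)^{(h_{1,i})}·…·(y'_{n'})^{(h_{n',i})} for all i, and this H satisfies λ_{i,j} = ∏_{1≤k,t≤n'} (λ'_{k,t})^{h_{k,i}·h_{t,j}} for all 1 ≤ i,j ≤ n; (b) conversely, for every matrix H = (h_{k,i}) ∈ M_{n'×n}(ℤ) satisfying λ_{i,j} = ∏_{1≤k,t≤n'} (λ'_{k,t})^{h_{k,i}·h_{t,j}} for all i,j, there exists a unique k-algebra homomorphism Φ : O_Λ((k*)^n) → O_{Λ'}((k*)^{n'})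 such that Φ(y_i) = (y'_1)^{(h_{1,i})}·…·(y'_{n'})^{(h_{n',i})} for all i. -/

import Mathlib

universe u

/-- A matrix is multiplicatively antisymmetric if `Λ i i = 1` and `Λ i j * Λ j i = 1`
for all `i, j`. -/
def Matrix.MulAntisymmetric {k : Type u} [Field k] {n : ℕ}
    (Λ : Matrix (Fin n) (Fin n) k) : Prop :=
  (∀ i, Λ i i = 1) ∧ ∀ i j, Λ i j * Λ j i = 1

inductive QTorusRel (k : Type u) [Field k] {n : ℕ} (Λ : Matrix (Fin n) (Fin n) k) :
    FreeAlgebra k (Fin n ⊕ Fin n) → FreeAlgebra k (Fin n ⊕ Fin n) → Prop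
  | comm (i j : Fin n) :
      QTorusRel k Λ (FreeAlgebra.ι k (Sum.inl i) * FreeAlgebra.ι k (Sum.inl j))
        (algebraMap k _ (Λ i j) * (FreeAlgebra.ι k (Sum.inl j) * FreeAlgebra.ι k (Sum.inl i)))
  | mul_inv (i : Fin n) :
      QTorusRel k Λ (FreeAlgebra.ι k (Sum.inl i) * FreeAlgebra.ι k (Sum.inr i)) 1
  | inv_mul (i : Fin n) :
      QTorusRel k Λ (FreeAlgebra.ι k (Sum.inr i) * FreeAlgebra.ι k (Sum.inl i)) 1

/-- The quantum torus `O_Λ((k*)^n)`. -/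
def QuantumTorus (k : Type u) [Field k] {n : ℕ} (Λ : Matrix (Fin n) (Fin n) k) :=
  RingQuot (QTorusRel k Λ)

noncomputable instance (k : Type u) [Field k] {n : ℕ} (Λ : Matrix (Fin n) (Fin n) k) :
    Ring (QuantumTorus k Λ) := by unfold QuantumTorus; infer_instance

noncomputable instance (k : Type u) [Field k] {n : ℕ} (Λ : Matrix (Fin n) (Fin n) k) :
    Algebra k (QuantumTorus k Λ) := by unfold QuantumTorus; infer_instance

/-- The generator `y_i` of the quantum torus. -/
noncomputable def QuantumTorus.y (k : Type u) [Field k] {n : ℕ}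
    (Λ : Matrix (Fin n) (Fin n) k) (i : Fin n) : QuantumTorus k Λ :=
  RingQuot.mkAlgHom k (QTorusRel k Λ) (FreeAlgebra.ι k (Sum.inl i))

/-- The generator `y_i⁻¹` of the quantum torus. -/
noncomputable def QuantumTorus.yinv (k : Type u) [Field k] {n : ℕ}
    (Λ : Matrix (Fin n) (Fin n) k) (i : Fin n) : QuantumTorus k Λ :=
  RingQuot.mkAlgHom k (QTorusRel k Λ) (FreeAlgebra.ι k (Sum.inr i))


/-- `y_i^{(h)}`: the `h`-th power (`h ∈ ℤ`) of the generator `y_i` of a quantum torus,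
using the inverse generator for negative exponents. -/
noncomputable def QuantumTorus.ypow (k : Type u) [Field k] {n : ℕ}
    (Λ : Matrix (Fin n) (Fin n) k) (i : Fin n) (h : ℤ) : QuantumTorus k Λ :=
  if 0 ≤ h then QuantumTorus.y k Λ i ^ h.toNat else QuantumTorus.yinv k Λ i ^ (-h).toNat

/-- The monomial `(y'_1)^{(H 1 i)} ⋯ (y'_{n'})^{(H n' i)}` of a quantum torus. -/
noncomputable def QuantumTorus.monomial (k : Type u) [Field k] {n n' : ℕ}
    (Λ' : Matrix (Fin n') (Fin n') k) (H : Matrix (Fin n') (Fin n) ℤ) (i : Fin n) :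
    QuantumTorus k Λ' :=
  ((List.finRange n').map fun K => QuantumTorus.ypow k Λ' K (H K i)).prod


section CentralCommutation

variable {C U : Type*} [CommGroup C] [Group U] {ι : C →* U}

/-- `u` and `v` commute up to the scalar `ι c`. -/
def CommuteUpTo (ι : C →* U) (c : C) (u v : U) : Prop := u * v = ι c * (v * u)

namespace CommuteUpTo

theorem symm {c : C} {u v : U} (h : CommuteUpTo ι c u v) : CommuteUpTo ι c⁻¹ v u := by
  unfold CommuteUpTo at *
  rw [h, map_inv, inv_mul_cancel_left]

theorem zpow_left (hι : ∀ c u, Commute (ι c) u) {c : C} {u v : U}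
    (h : CommuteUpTo ι c u v) (m : ℤ) : CommuteUpTo ι (c ^ m) (u ^ m) v := by
  have h' : SemiconjBy v (ι c * u) u := by
    unfold SemiconjBy CommuteUpTo at *
    rw [h, ← mul_assoc, ← (hι c v).eq, mul_assoc]
  have := (h'.zpow_right m).eq
  rw [(hι c u).mul_zpow, ← map_zpow, ← mul_assoc, ← (hι _ v).eq, mul_assoc] at this
  exact this.symm

theorem zpow_right (hι : ∀ c u, Commute (ι c) u) {c : C} {u v : U}
    (h : CommuteUpTo ι c u v) (m : ℤ) : CommuteUpTo ι (c ^ m) u (v ^ m) := by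
  simpa using (h.symm.zpow_left hι m).symm

theorem mul_left (hι : ∀ c u, Commute (ι c) u) {c d : C} {u u' v : U}
    (h : CommuteUpTo ι c u v) (h' : CommuteUpTo ι d u' v) :
    CommuteUpTo ι (c * d) (u * u') v := by
  unfold CommuteUpTo at *
  rw [mul_assoc, h', ← mul_assoc u, ← (hι d u).eq, mul_assoc, ← mul_assoc u, h, map_mul,
    (hι c (ι d)).eq]
  simp only [mul_assoc]

theorem list_prod_left (hι : ∀ c u, Commute (ι c) u) {I : Type*} {c : I → C} {f : I → U} {v : U}
    (h : ∀ i, CommuteUpTo ι (c i) (f i) v) (l : List I) :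
    CommuteUpTo ι (l.map c).prod (l.map f).prod v := by
  induction l with
  | nil => simp [CommuteUpTo]
  | cons i l ih => simpa using (h i).mul_left hι ih

theorem list_prod_right (hι : ∀ c u, Commute (ι c) u) {I : Type*} {c : I → C} {f : I → U} {v : U}
    (h : ∀ i, CommuteUpTo ι (c i) v (f i)) (l : List I) :
    CommuteUpTo ι (l.map c).prod v (l.map f).prod := by
  have := (list_prod_left hι (fun i => (h i).symm) l).symm
  rwa [List.prod_inv, List.map_map, Function.comp_def, funext fun i => inv_inv (c i)] at this

/-- The product of two ordered monomials is a scalar multiple of an ordered monomial. -/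
theorem exists_list_prod_mul (hι : ∀ c u, Commute (ι c) u) {I : Type*} {c : I → I → C} {f : I → U}
    (h : ∀ i j, CommuteUpTo ι (c i j) (f i) (f j)) (a b : I → ℤ) (l : List I) :
    ∃ z : C, (l.map fun i => f i ^ a i).prod * (l.map fun i => f i ^ b i).prod =
      ι z * (l.map fun i => f i ^ (a i + b i)).prod := by
  induction l with
  | nil => exact ⟨1, by simp⟩
  | cons i l ih =>
    obtain ⟨z, hz⟩ := ih
    have hl := list_prod_left hι (fun j => ((h j i).zpow_left hι (a j)).zpow_right hι (b i)) l
    unfold CommuteUpTo at hl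
    set w := (l.map fun j => (c j i ^ a j) ^ b i).prod
    refine ⟨w * z, ?_⟩
    simp only [List.map_cons, List.prod_cons]
    set P := (l.map fun i => f i ^ a i).prod
    set Q := (l.map fun i => f i ^ b i).prod
    set R := (l.map fun i => f i ^ (a i + b i)).prod
    calc f i ^ a i * P * (f i ^ b i * Q) = f i ^ a i * (P * f i ^ b i) * Q := by group
      _ = f i ^ a i * ι w * (f i ^ b i * (P * Q)) := by rw [hl]; group
      _ = ι w * f i ^ a i * (f i ^ b i * ι z * R) := by rw [hz, (hι w _).eq]; group
      _ = ι w * (f i ^ a i * ι z) * (f i ^ b i * R) := by rw [← (hι z (f i ^ b i)).eq]; group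
      _ = _ := by rw [← (hι z (f i ^ a i)).eq, map_mul, zpow_add]; group

end CommuteUpTo

end CentralCommutation

/-- In an algebra with a basis indexed by a group with the two-unique-sums property, multiplying
like the group up to nonzero scalars, every unit is a scalar multiple of a basis vector. -/
theorem Module.Basis.exists_eq_smul_of_isUnit {k A G : Type*} [Field k] [Ring A] [Algebra k A]
    [AddCommGroup G] [TwoUniqueSums G] (b : Module.Basis G k A) {c : G → G → k}
    (hc : ∀ g h, c g h ≠ 0) (hb : ∀ g h, b g * b h = c g h • b (g + h)) (h1 : ∃ s : k, 1 = s • b 0)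
    {x : A} (hx : IsUnit x) : ∃ (s : k) (g : G), s ≠ 0 ∧ x = s • b g := by
  classical
  obtain ⟨s₁, h1⟩ := h1
  obtain ⟨⟨x, z, hxz, hzx⟩, rfl⟩ := hx
  change ∃ (s : k) (g : G), s ≠ 0 ∧ x = s • b g
  have hA : (1 : A) ≠ 0 := by
    intro h0
    apply b.ne_zero 0
    rw [← one_mul (b 0), h0, zero_mul]
  have hmul : x * z = ∑ p ∈ (b.repr x).support ×ˢ (b.repr z).support,
      (b.repr x p.1 * b.repr z p.2 * c p.1 p.2) • b (p.1 + p.2) := by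
    conv_lhs => rw [← b.linearCombination_repr x, ← b.linearCombination_repr z,
      Finsupp.linearCombination_apply, Finsupp.linearCombination_apply, Finsupp.sum, Finsupp.sum,
      Finset.sum_mul_sum, ← Finset.sum_product']
    refine Finset.sum_congr rfl fun p _ => ?_
    rw [smul_mul_smul_comm, hb, smul_smul]
  have hcoeff : ∀ p ∈ (b.repr x).support ×ˢ (b.repr z).support,
      UniqueAdd (b.repr x).support (b.repr z).support p.1 p.2 → p.1 + p.2 = 0 := by
    intro p hp hu
    by_contra hne
    have h2 : b.repr (x * z) (p.1 + p.2) = 0 := by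
      rw [hxz, h1]
      simp [Ne.symm hne]
    rw [hmul, map_sum, Finsupp.finsetSum_apply, Finset.sum_eq_single p] at h2
    · rw [Finset.mem_product, Finsupp.mem_support_iff, Finsupp.mem_support_iff] at hp
      simp [hp.1, hp.2, hc] at h2
    · intro q hq hqp
      have : q.1 + q.2 ≠ p.1 + p.2 := fun h => hqp <| by
        rw [Finset.mem_product] at hq
        exact Prod.ext_iff.2 (hu hq.1 hq.2 h)
      simp [this]
    · exact fun h => absurd hp h
  have hx0 : x ≠ 0 := fun h => hA (by rw [← hxz, h, zero_mul])
  have hz0 : z ≠ 0 := fun h => hA (by rw [← hxz, h, mul_zero])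
  have hxs : 0 < (b.repr x).support.card := by
    rw [Finset.card_pos, Finsupp.support_nonempty_iff]; simpa using hx0
  have hzs : 0 < (b.repr z).support.card := by
    rw [Finset.card_pos, Finsupp.support_nonempty_iff]; simpa using hz0
  have hcard : (b.repr x).support.card = 1 := by
    by_contra hne
    obtain ⟨p, hp, q, hq, hpq, hup, huq⟩ := TwoUniqueSums.uniqueAdd_of_one_lt_card
      (A := (b.repr x).support) (B := (b.repr z).support)
      (lt_of_lt_of_le (by omega : 1 < (b.repr x).support.card) (Nat.le_mul_of_pos_right _ hzs))
    refine hpq (Prod.ext_iff.2 (huq (Finset.mem_product.1 hp).1 (Finset.mem_product.1 hp).2 ?_))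
    rw [hcoeff p hp hup, hcoeff q hq huq]
  obtain ⟨g, s, hs, hg⟩ := Finsupp.card_support_eq_one'.1 hcard
  exact ⟨s, g, hs, b.repr.injective (by simp [hg])⟩

namespace QuantumTorus

variable {k : Type u} [Field k] {n : ℕ}

section Presentation

variable (Λ : Matrix (Fin n) (Fin n) k)

/-- The presentation of the quantum torus as a quotient of a free algebra. -/
noncomputable def ofFree : FreeAlgebra k (Fin n ⊕ Fin n) →ₐ[k] QuantumTorus k Λ :=
  RingQuot.mkAlgHom k (QTorusRel k Λ)

theorem ofFree_surjective : Function.Surjective (ofFree Λ) :=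
  RingQuot.mkAlgHom_surjective k (QTorusRel k Λ)

theorem ofFree_rel {a b : FreeAlgebra k (Fin n ⊕ Fin n)} (h : QTorusRel k Λ a b) :
    ofFree Λ a = ofFree Λ b :=
  RingQuot.mkAlgHom_rel k h

@[simp] theorem ofFree_inl (i : Fin n) : ofFree Λ (FreeAlgebra.ι k (Sum.inl i)) = y k Λ i := rfl

@[simp] theorem ofFree_inr (i : Fin n) : ofFree Λ (FreeAlgebra.ι k (Sum.inr i)) = yinv k Λ i := rfl

theorem y_mul_y (i j : Fin n) : y k Λ i * y k Λ j = algebraMap k _ (Λ i j) * (y k Λ j * y k Λ i) := by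
  simpa using ofFree_rel Λ (QTorusRel.comm i j)

theorem y_mul_yinv (i : Fin n) : y k Λ i * yinv k Λ i = 1 := by
  simpa using ofFree_rel Λ (QTorusRel.mul_inv i)

theorem yinv_mul_y (i : Fin n) : yinv k Λ i * y k Λ i = 1 := by
  simpa using ofFree_rel Λ (QTorusRel.inv_mul i)

/-- The generator `y_i` as a unit. -/
@[simps] noncomputable def yUnit (i : Fin n) : (QuantumTorus k Λ)ˣ where
  val := y k Λ i
  inv := yinv k Λ i
  val_inv := y_mul_yinv Λ i
  inv_val := yinv_mul_y Λ i

theorem ypow_eq (i : Fin n) (h : ℤ) : ypow k Λ i h = ↑(yUnit Λ i ^ h) := by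
  unfold ypow
  split_ifs with h0
  · lift h to ℕ using h0
    simp
  · obtain ⟨m, rfl⟩ : ∃ m : ℕ, h = -m := ⟨(-h).toNat, by omega⟩
    simp [← inv_pow]

/-- The ordered monomial with exponent vector `a`, as a unit. -/
noncomputable def monomialUnit (a : Fin n → ℤ) : (QuantumTorus k Λ)ˣ :=
  ((List.finRange n).map fun i => yUnit Λ i ^ a i).prod

theorem monomial_eq {m : ℕ} (H : Matrix (Fin n) (Fin m) ℤ) (i : Fin m) :
    monomial k Λ H i = ↑(monomialUnit Λ fun j => H j i) := by
  unfold monomial monomialUnit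
  rw [← Units.coeHom_apply, map_list_prod, List.map_map]
  simp [Function.comp_def, ypow_eq]

theorem monomialUnit_zero : monomialUnit Λ 0 = 1 := by
  simp [monomialUnit]

theorem monomialUnit_single (i : Fin n) (m : ℤ) :
    monomialUnit Λ (Pi.single i m) = yUnit Λ i ^ m := by
  unfold monomialUnit
  rw [List.prod_map_eq_pow_single i]
  · simp
  · intro j hj _
    simp [Pi.single_eq_of_ne hj]

variable {Λ} in
theorem algHom_ext {B : Type*} [Ring B] [Algebra k B] {Φ Ψ : QuantumTorus k Λ →ₐ[k] B}
    (h : ∀ i, Φ (y k Λ i) = Ψ (y k Λ i)) : Φ = Ψ := by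
  have hinv : ∀ i, Φ (yinv k Λ i) = Ψ (yinv k Λ i) := fun i =>
    left_inv_eq_right_inv (b := Φ (yinv k Λ i)) (a := Φ (y k Λ i))
      (by rw [← map_mul, yinv_mul_y, map_one]) (by rw [h, ← map_mul, y_mul_yinv, map_one])
  have : Φ.comp (ofFree Λ) = Ψ.comp (ofFree Λ) := by
    apply FreeAlgebra.hom_ext
    funext i
    cases i with
    | inl i => exact h i
    | inr i => exact hinv i
  ext x
  obtain ⟨w, rfl⟩ := ofFree_surjective Λ x
  exact DFunLike.congr_fun this w

/-- Units satisfying the defining commutation relations induce a map from the quantum torus. -/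
theorem exists_algHom {B : Type*} [Ring B] [Algebra k B] (u : Fin n → Bˣ)
    (hu : ∀ i j, (u i * u j : B) = algebraMap k B (Λ i j) * (u j * u i)) :
    ∃ Φ : QuantumTorus k Λ →ₐ[k] B, ∀ i, Φ (y k Λ i) = u i := by
  let f := FreeAlgebra.lift k (Sum.elim (fun i => (u i : B)) fun i => ((u i)⁻¹ : Bˣ))
  have hf : ∀ ⦃a b⦄, QTorusRel k Λ a b → f a = f b := by
    rintro _ _ (⟨i, j⟩ | i | i)
    · simpa [f] using hu i j
    · simp [f]
    · simp [f]
  refine ⟨(RingQuot.liftAlgHom k ⟨f, hf⟩ : RingQuot (QTorusRel k Λ) →ₐ[k] B), fun i => ?_⟩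
  have := RingQuot.liftAlgHom_mkAlgHom_apply k f hf (FreeAlgebra.ι k (Sum.inl i))
  exact this.trans (by simp [f])

/-- Nonzero scalars as units of the quantum torus. -/
noncomputable def scalarUnit : kˣ →* (QuantumTorus k Λ)ˣ :=
  Units.map (algebraMap k (QuantumTorus k Λ) : k →* QuantumTorus k Λ)

@[simp] theorem val_scalarUnit (c : kˣ) :
    (scalarUnit Λ c : QuantumTorus k Λ) = algebraMap k (QuantumTorus k Λ) c := rfl

theorem commute_scalarUnit (c : kˣ) (u : (QuantumTorus k Λ)ˣ) : Commute (scalarUnit Λ c) u :=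
  Units.ext (Algebra.commutes (c : k) (u : QuantumTorus k Λ))

theorem _root_.Matrix.MulAntisymmetric.ne_zero {Λ : Matrix (Fin n) (Fin n) k}
    (hΛ : Λ.MulAntisymmetric) (i j : Fin n) : Λ i j ≠ 0 :=
  left_ne_zero_of_mul_eq_one (hΛ.2 i j)

variable {Λ}

theorem commuteUpTo_yUnit (hΛ : Λ.MulAntisymmetric) (i j : Fin n) :
    CommuteUpTo (scalarUnit Λ) (Units.mk0 (Λ i j) (hΛ.ne_zero i j)) (yUnit Λ i) (yUnit Λ j) :=
  Units.ext (y_mul_y Λ i j)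

theorem monomialUnit_mul (hΛ : Λ.MulAntisymmetric) (a b : Fin n → ℤ) :
    ∃ z : kˣ, monomialUnit Λ a * monomialUnit Λ b = scalarUnit Λ z * monomialUnit Λ (a + b) :=
  CommuteUpTo.exists_list_prod_mul (commute_scalarUnit Λ) (commuteUpTo_yUnit hΛ) a b _

theorem monomialUnit_mul_comm (hΛ : Λ.MulAntisymmetric) (a b : Fin n → ℤ) :
    (monomialUnit Λ a * monomialUnit Λ b : QuantumTorus k Λ) =
      algebraMap k _ (∏ i, ∏ j, Λ i j ^ (a i * b j)) * (monomialUnit Λ b * monomialUnit Λ a) := by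
  have hι := commute_scalarUnit Λ
  have h := CommuteUpTo.list_prod_left hι (fun i =>
    CommuteUpTo.list_prod_right hι (fun j =>
      ((commuteUpTo_yUnit hΛ i j).zpow_left hι (a i)).zpow_right hι (b j)) (List.finRange n))
    (List.finRange n)
  have h' := congrArg Units.val h
  simpa [← Fin.prod_univ_def, Units.coe_prod, zpow_mul, monomialUnit] using h'

theorem span_monomialUnit (hΛ : Λ.MulAntisymmetric) :
    Submodule.span k (Set.range fun a => (monomialUnit Λ a : QuantumTorus k Λ)) = ⊤ := by
  set S := Submodule.span k (Set.range fun a => (monomialUnit Λ a : QuantumTorus k Λ)) with hS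
  have hmul : ∀ a, ∀ s ∈ S, (monomialUnit Λ a : QuantumTorus k Λ) * s ∈ S := by
    intro a s hs
    induction hs using Submodule.span_induction with
    | mem x hx =>
      obtain ⟨b, rfl⟩ := hx
      obtain ⟨z, hz⟩ := monomialUnit_mul hΛ a b
      have hz' := congrArg Units.val hz
      simp only [Units.val_mul, val_scalarUnit, ← Algebra.smul_def] at hz'
      simp only [hz']
      exact S.smul_mem _ (Submodule.subset_span ⟨_, rfl⟩)
    | zero => simp
    | add x y _ _ hx hy => rw [mul_add]; exact S.add_mem hx hy
    | smul c x _ hx => rw [mul_smul_comm]; exact S.smul_mem _ hx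
  have hfree : ∀ w, ∀ s ∈ S, ofFree Λ w * s ∈ S := by
    intro w
    induction w using FreeAlgebra.induction with
    | grade0 r =>
      intro s hs
      rw [AlgHom.commutes, ← Algebra.smul_def]
      exact S.smul_mem _ hs
    | grade1 i =>
      intro s hs
      cases i with
      | inl i => simpa [monomialUnit_single] using hmul (Pi.single i 1) s hs
      | inr i => simpa [monomialUnit_single] using hmul (Pi.single i (-1)) s hs
    | mul a b ha hb =>
      intro s hs
      rw [map_mul, mul_assoc]
      exact ha _ (hb s hs)
    | add a b ha hb =>
      intro s hs
      rw [map_add, add_mul]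
      exact S.add_mem (ha s hs) (hb s hs)
  refine eq_top_iff.2 fun x _ => ?_
  obtain ⟨w, rfl⟩ := ofFree_surjective Λ x
  rw [← mul_one (ofFree Λ w)]
  refine hfree w 1 (Submodule.subset_span ⟨0, ?_⟩)
  simp [monomialUnit_zero]

end Presentation

section Representation

variable (Λ : Matrix (Fin n) (Fin n) k)

/-- The coefficient of `e_{a + ε_i}` in the action of `y_i` on `e_a`. -/
noncomputable def shiftCoeff (i : Fin n) (a : Fin n → ℤ) : k :=
  ∏ t, (if t < i then Λ i t else 1) ^ a t

variable {Λ}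

theorem shiftCoeff_ne_zero (hΛ : Λ.MulAntisymmetric) (i : Fin n) (a : Fin n → ℤ) :
    shiftCoeff Λ i a ≠ 0 := by
  refine Finset.prod_ne_zero_iff.2 fun t _ => zpow_ne_zero _ ?_
  split_ifs
  exacts [hΛ.ne_zero i t, one_ne_zero]

theorem shiftCoeff_add_single (hΛ : Λ.MulAntisymmetric) (i j : Fin n) (a : Fin n → ℤ) :
    shiftCoeff Λ i (a + Pi.single j 1) = shiftCoeff Λ i a * if j < i then Λ i j else 1 := by
  have h : ∀ t, (if t < i then Λ i t else 1) ≠ 0 := fun t => by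
    split_ifs
    exacts [hΛ.ne_zero i t, one_ne_zero]
  simp only [shiftCoeff, Pi.add_apply, zpow_add₀ (h _), Finset.prod_mul_distrib]
  congr 1
  rw [Finset.prod_eq_single j]
  · simp
  · intro t _ htj
    simp [Pi.single_eq_of_ne htj]
  · simp

/-- The action of `y_i` on the free module with basis `ℤ^n`. -/
noncomputable def shift (hΛ : Λ.MulAntisymmetric) (i : Fin n) :
    (Module.End k ((Fin n → ℤ) →₀ k))ˣ where
  val := Finsupp.linearCombination k fun a => Finsupp.single (a + Pi.single i 1) (shiftCoeff Λ i a)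
  inv := Finsupp.linearCombination k fun a => Finsupp.single (a - Pi.single i 1) (shiftCoeff Λ i a)⁻¹
  val_inv := by
    ext a : 2
    have := shiftCoeff_add_single hΛ i i (a - Pi.single i 1)
    simp only [sub_add_cancel, lt_irrefl, if_false, mul_one] at this
    simp [← this, shiftCoeff_ne_zero hΛ i a]
  inv_val := by
    ext a : 2
    have := shiftCoeff_add_single hΛ i i a
    simp only [lt_irrefl, if_false, mul_one] at this
    simp [this, shiftCoeff_ne_zero hΛ i a]

theorem shift_single (hΛ : Λ.MulAntisymmetric) (i : Fin n) (a : Fin n → ℤ) (c : k) :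
    (shift hΛ i).val (Finsupp.single a c) =
      Finsupp.single (a + Pi.single i 1) (c * shiftCoeff Λ i a) := by
  simp [shift]

theorem shift_mul_shift (hΛ : Λ.MulAntisymmetric) (i j : Fin n) :
    (shift hΛ i * shift hΛ j : Module.End k ((Fin n → ℤ) →₀ k)) =
      algebraMap k _ (Λ i j) * (shift hΛ j * shift hΛ i) := by
  ext a : 2
  have key : (if j < i then Λ i j else 1) = Λ i j * if i < j then Λ j i else 1 := by
    rcases lt_trichotomy i j with h | rfl | h
    · simp [h, h.not_gt, hΛ.2]
    · simp [hΛ.1]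
    · simp [h, h.not_gt]
  simp only [LinearMap.comp_apply, Finsupp.lsingle_apply, Module.End.mul_apply, shift_single,
    Module.algebraMap_end_apply, Finsupp.smul_single, shiftCoeff_add_single hΛ, key, smul_eq_mul,
    add_right_comm a (Pi.single i 1)]
  congr 1
  ring

/-- Units acting on the free module with basis `ℤ^n` by a weighted shift by `g`. -/
def ActsByShift (u : (Module.End k ((Fin n → ℤ) →₀ k))ˣ) (g : Fin n → ℤ) : Prop :=
  ∀ a, ∃ c : k, c ≠ 0 ∧ u.val (Finsupp.single a 1) = Finsupp.single (a + g) c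

namespace ActsByShift

variable {u v : (Module.End k ((Fin n → ℤ) →₀ k))ˣ} {g h : Fin n → ℤ}

theorem one : ActsByShift (1 : (Module.End k ((Fin n → ℤ) →₀ k))ˣ) 0 :=
  fun a => ⟨1, one_ne_zero, by simp⟩

theorem mul (hu : ActsByShift u g) (hv : ActsByShift v h) : ActsByShift (u * v) (g + h) := by
  intro a
  obtain ⟨c, hc, hv⟩ := hv a
  obtain ⟨d, hd, hu⟩ := hu (a + h)
  refine ⟨c * d, mul_ne_zero hc hd, ?_⟩
  rw [Units.val_mul, Module.End.mul_apply, hv, ← mul_one c, ← smul_eq_mul, ← Finsupp.smul_single,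
    map_smul, hu]
  simp [add_assoc, add_comm g]

theorem inv (hu : ActsByShift u g) : ActsByShift u⁻¹ (-g) := by
  intro a
  obtain ⟨c, hc, hu⟩ := hu (a + -g)
  refine ⟨c⁻¹, inv_ne_zero hc, ?_⟩
  rw [neg_add_cancel_right] at hu
  have h1 : Finsupp.single a (1 : k) = c⁻¹ • u.val (Finsupp.single (a + -g) 1) := by
    rw [hu]; simp [hc]
  rw [h1, map_smul, ← Module.End.mul_apply, Units.inv_mul]
  simp

theorem zpow (hu : ActsByShift u g) (m : ℤ) : ActsByShift (u ^ m) (m • g) := by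
  induction m with
  | zero => simpa using one
  | succ m ih => simpa only [zpow_add_one, add_smul, one_smul] using ih.mul hu
  | pred m ih =>
    have := ih.mul hu.inv
    rw [← zpow_sub_one, ← sub_eq_add_neg] at this
    rwa [sub_smul, one_smul]

theorem list_prod {I : Type*} {f : I → (Module.End k ((Fin n → ℤ) →₀ k))ˣ} {g : I → Fin n → ℤ}
    (h : ∀ i, ActsByShift (f i) (g i)) (l : List I) :
    ActsByShift (l.map f).prod (l.map g).sum := by
  induction l with
  | nil => exact one
  | cons i l ih => simpa using (h i).mul ih

end ActsByShift

theorem linearIndependent_monomialUnit (hΛ : Λ.MulAntisymmetric) :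
    LinearIndependent k fun a => (monomialUnit Λ a : QuantumTorus k Λ) := by
  obtain ⟨ρ, hρ⟩ := exists_algHom Λ (B := Module.End k ((Fin n → ℤ) →₀ k)) (shift hΛ)
    (shift_mul_shift hΛ)
  have hy : ∀ i, Units.map (ρ : QuantumTorus k Λ →* _) (yUnit Λ i) = shift hΛ i :=
    fun i => Units.ext (hρ i)
  have hact : ∀ a, ActsByShift (Units.map (ρ : QuantumTorus k Λ →* Module.End k ((Fin n → ℤ) →₀ k))
      (monomialUnit Λ a)) a := by
    intro a
    have h : ∀ i, ActsByShift (shift hΛ i ^ a i) (a i • Pi.single i 1) := fun i =>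
      ActsByShift.zpow (fun b => ⟨shiftCoeff Λ i b, shiftCoeff_ne_zero hΛ i b, by
        simp [shift_single]⟩) _
    convert ActsByShift.list_prod h (List.finRange n)
    · simp [monomialUnit, map_list_prod, Function.comp_def, hy]
    · rw [← Fin.sum_univ_def, ← pi_eq_sum_univ' a]
  choose c hc hcρ using fun a => hact a 0
  let ev : QuantumTorus k Λ →ₗ[k] ((Fin n → ℤ) →₀ k) :=
    (LinearMap.applyₗ (Finsupp.single 0 1)).comp ρ.toLinearMap
  apply LinearIndependent.of_comp ev
  have h := (Finsupp.basisSingleOne (R := k) (ι := Fin n → ℤ)).linearIndependent.units_smul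
    fun a => Units.mk0 (c a) (hc a)
  convert h using 1
  funext a
  simpa [ev, Units.smul_def] using hcρ a

/-- The ordered monomials form a basis of the quantum torus. -/
noncomputable def monomialBasis (hΛ : Λ.MulAntisymmetric) :
    Module.Basis (Fin n → ℤ) k (QuantumTorus k Λ) :=
  Module.Basis.mk (linearIndependent_monomialUnit hΛ) (span_monomialUnit hΛ).ge

@[simp] theorem monomialBasis_apply (hΛ : Λ.MulAntisymmetric) (a : Fin n → ℤ) :
    monomialBasis hΛ a = monomialUnit Λ a := by
  simp [monomialBasis]

theorem nontrivial (hΛ : Λ.MulAntisymmetric) : Nontrivial (QuantumTorus k Λ) :=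
  ⟨_, _, (monomialBasis hΛ).ne_zero 0⟩

theorem exists_eq_of_isUnit (hΛ : Λ.MulAntisymmetric) {x : QuantumTorus k Λ} (hx : IsUnit x) :
    ∃ (s : k) (a : Fin n → ℤ), s ≠ 0 ∧ x = algebraMap k _ s * monomialUnit Λ a := by
  choose z hz using monomialUnit_mul hΛ
  obtain ⟨s, a, hs, h⟩ := (monomialBasis hΛ).exists_eq_smul_of_isUnit
    (c := fun a b => (z a b : k)) (fun a b => (z a b).ne_zero)
    (fun a b => by simpa [Algebra.smul_def] using congrArg Units.val (hz a b))
    ⟨1, by simp [monomialUnit_zero]⟩ hx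
  exact ⟨s, a, hs, by simpa [Algebra.smul_def] using h⟩

theorem eq_of_smul_monomialUnit_eq (hΛ : Λ.MulAntisymmetric) {s t : k} (hs : s ≠ 0)
    {a b : Fin n → ℤ} (h : algebraMap k _ s * (monomialUnit Λ a : QuantumTorus k Λ) =
      algebraMap k _ t * monomialUnit Λ b) : s = t ∧ a = b := by
  have h' := congrArg (monomialBasis hΛ).repr h
  simp only [← Algebra.smul_def, ← monomialBasis_apply hΛ, map_smul, Module.Basis.repr_self,
    Finsupp.smul_single, smul_eq_mul, mul_one] at h'
  rcases (Finsupp.single_eq_single_iff _ _ _ _).1 h' with h | h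
  exacts [⟨h.2, h.1⟩, absurd h.1 hs]

end Representation

end QuantumTorus

/-- (a) Every `k`-algebra homomorphism `Φ` between quantum tori sends each
generator `y_i` to a unique scalar multiple `α_i·(y'_1)^{(h_{1,i})}⋯(y'_{n'})^{(h_{n',i})}`
of a monomial, and the exponent matrix `H` satisfies
`λ_{i,j} = ∏_{K,t} (λ'_{K,t})^{h_{K,i}·h_{t,j}}`; (b) conversely every integer matrix `H`
satisfying these equations arises from a unique homomorphism sending `y_i` to the monomial
determined by the `i`-th column of `H`. -/
theorem stmt6 {k : Type u} [Field k] [CharZero k] {n n' : ℕ} (hn : 1 ≤ n) (hn' : 1 ≤ n')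
    (Λ : Matrix (Fin n) (Fin n) k) (hΛ : Λ.MulAntisymmetric)
    (Λ' : Matrix (Fin n') (Fin n') k) (hΛ' : Λ'.MulAntisymmetric) :
    (∀ Φ : QuantumTorus k Λ →ₐ[k] QuantumTorus k Λ',
      (∃! p : (Fin n → k) × Matrix (Fin n') (Fin n) ℤ,
        ∀ i : Fin n, p.1 i ≠ 0 ∧
          Φ (QuantumTorus.y k Λ i) =
            algebraMap k (QuantumTorus k Λ') (p.1 i) * QuantumTorus.monomial k Λ' p.2 i) ∧
      (∀ (α : Fin n → k) (H : Matrix (Fin n') (Fin n) ℤ),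
        (∀ i : Fin n, α i ≠ 0 ∧
          Φ (QuantumTorus.y k Λ i) =
            algebraMap k (QuantumTorus k Λ') (α i) * QuantumTorus.monomial k Λ' H i) →
        ∀ i j : Fin n, Λ i j = ∏ K : Fin n', ∏ t : Fin n', Λ' K t ^ (H K i * H t j))) ∧
    (∀ H : Matrix (Fin n') (Fin n) ℤ,
      (∀ i j : Fin n, Λ i j = ∏ K : Fin n', ∏ t : Fin n', Λ' K t ^ (H K i * H t j)) →
      ∃! Φ : QuantumTorus k Λ →ₐ[k] QuantumTorus k Λ',
        ∀ i : Fin n, Φ (QuantumTorus.y k Λ i) = QuantumTorus.monomial k Λ' H i) := by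
  refine ⟨fun Φ => ⟨?_, fun α H hΦ i j => ?_⟩, fun H hH => ?_⟩
  · have hu : ∀ i, IsUnit (Φ (QuantumTorus.y k Λ i)) := fun i =>
      (QuantumTorus.yUnit Λ i).isUnit.map Φ
    choose s a hs h using fun i => QuantumTorus.exists_eq_of_isUnit hΛ' (hu i)
    refine ⟨(s, fun K i => a i K), fun i => ⟨hs i, ?_⟩, fun p hp => ?_⟩
    · rw [QuantumTorus.monomial_eq, h]
    · have key : ∀ i, p.1 i = s i ∧ (fun K => p.2 K i) = a i := fun i => by
        obtain ⟨h0, h1⟩ := hp i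
        rw [QuantumTorus.monomial_eq, h] at h1
        exact QuantumTorus.eq_of_smul_monomialUnit_eq hΛ' h0 h1.symm
      refine Prod.ext (funext fun i => (key i).1) ?_
      ext K i
      exact congrFun (key i).2 K
  · have := QuantumTorus.nontrivial hΛ'
    simp only [QuantumTorus.monomial_eq, ← Algebra.smul_def] at hΦ
    have h := congrArg Φ (QuantumTorus.y_mul_y Λ i j)
    simp only [map_mul, AlgHom.commutes, (hΦ _).2, smul_mul_smul_comm] at h
    rw [QuantumTorus.monomialUnit_mul_comm hΛ', mul_comm (α j), ← Algebra.smul_def,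
      ← Algebra.smul_def, smul_smul, smul_smul, ← Units.val_mul, Algebra.smul_def,
      Algebra.smul_def, Units.mul_left_inj] at h
    have h' := (algebraMap k (QuantumTorus k Λ')).injective h
    rw [mul_comm (Λ i j)] at h'
    exact (mul_left_cancel₀ (mul_ne_zero (hΦ i).1 (hΦ j).1) h').symm
  · obtain ⟨Φ, hΦ⟩ := QuantumTorus.exists_algHom Λ
      (fun i => QuantumTorus.monomialUnit Λ' fun K => H K i) fun i j => by
        rw [hH i j]
        exact QuantumTorus.monomialUnit_mul_comm hΛ' _ _
    refine ⟨Φ, fun i => by rw [hΦ, QuantumTorus.monomial_eq], fun Ψ hΨ => ?_⟩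
    exact QuantumTorus.algHom_ext fun i => by rw [hΨ, hΦ, QuantumTorus.monomial_eq]
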